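/- arXiv:2105.07900 — 12 statements merged into one kernel-verified Lean document; each statement's English description precedes it below -/
import Mathlib

section
/- Let m be a natural number, let (a_k)_{k=0}^{m} be nonnegative real numbers, and let γ > 0. If a_{k+1} ≤ a_k − γ·a_k² for every k with 0 ≤ k ≤ m−1, then a_m ≤ a_0 / (1 + m·γ·a_0). -/
/-- One step of the recursion `y ≤ x - γ * x ^ 2` improves the bound `x ≤ c / D` to
`y ≤ c / (D + γ * c)`. -/
theorem mul_add_mul_le_of_le_sub_mul_sq {x y c D γ : ℝ} (hγ : 0 ≤ γ) (hx : 0 ≤ x) (hc : 0 ≤ c)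
    (hD : 0 ≤ D) (hxD : x * D ≤ c) (hy : y ≤ x - γ * x ^ 2) :
    y * (D + γ * c) ≤ c := by
  have hpos : 0 < 1 + γ * x := by positivity
  have hyx : y * (1 + γ * x) ≤ x := by
    have hcube : 0 ≤ γ ^ 2 * x ^ 3 := by positivity
    calc y * (1 + γ * x) ≤ (x - γ * x ^ 2) * (1 + γ * x) := by gcongr
      _ = x - γ ^ 2 * x ^ 3 := by ring
      _ ≤ x := by linarith
  refine le_of_mul_le_mul_right ?_ hpos
  calc y * (D + γ * c) * (1 + γ * x) = y * (1 + γ * x) * (D + γ * c) := by ring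
    _ ≤ x * (D + γ * c) := by gcongr
    _ = x * D + γ * c * x := by ring
    _ ≤ c + γ * c * x := by gcongr
    _ = c * (1 + γ * x) := by ring

/-- Lemma 3.1 (Polyak; Beck–Teboulle): if a nonnegative sequence satisfies
`a (k+1) ≤ a k - γ * (a k)^2` for `0 ≤ k ≤ m-1`, then `a m ≤ a 0 / (1 + m * γ * a 0)`. -/
theorem stmt_0 (m : ℕ) (a : ℕ → ℝ) (γ : ℝ) (hγ : 0 < γ)
    (hnonneg : ∀ k, k ≤ m → 0 ≤ a k)
    (hrec : ∀ k, k < m → a (k + 1) ≤ a k - γ * (a k) ^ 2) :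
    a m ≤ a 0 / (1 + (m : ℝ) * γ * a 0) := by
  have h0 : 0 ≤ a 0 := hnonneg 0 (Nat.zero_le m)
  have key : ∀ k ≤ m, a k * (1 + (k : ℝ) * γ * a 0) ≤ a 0 := by
    intro k
    induction k with
    | zero => simp
    | succ k ih =>
      intro hk
      have hstep := mul_add_mul_le_of_le_sub_mul_sq hγ.le (hnonneg k (by omega)) h0
        (by positivity) (ih (by omega)) (hrec k hk)
      convert hstep using 2
      push_cast
      ring
  rw [le_div_iff₀ (by positivity)]
  exact key m le_rfl
end

section
/- Let H be a real inner product space, μ ∈ H, and let (ν_t)_{t≥1} be a sequence in H and (g_t)_{t≥1} a sequence in H with g_t ≠ 0 for all t. Assume that for every t: ⟨μ − ν_t, g_t⟩ ≥ 0, γ_t = min{⟨μ − ν_t, g_t⟩/‖g_t‖², 1}, and ν_{t+1} = ν_t + γ_t·g_t. Fix T ≥ 1 and assume ν_i ≠ μ for all 1 ≤ i ≤ T−1. Define ε_t = (1/2)‖μ − ν_t‖², cos θ_i = ⟨μ − ν_i, g_i⟩/(‖μ − ν_i‖·‖g_i‖), and A_T = {i ∈ {1,…,T−1} : γ_i ≠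 1}. Then ε_T ≤ ε_1 · ∏_{i ∈ A_T} (1 − cos²θ_i). Moreover, if γ_i < 1 for every i ∈ {1,…,T−1}, then ε_T = ε_1 · ∏_{i=1}^{T−1} (1 − cos²θ_i). -/
open RealInnerProductSpace Finset

section LineSearch

variable {H : Type*} [NormedAddCommGroup H] [InnerProductSpace ℝ H]

/-- The exact line-search step along `g` contracts the squared norm by `1 - cos²`. -/
lemma norm_sub_line_search_sq {d g : H} (hd : d ≠ 0) (hg : g ≠ 0) :
    ‖d - (⟪d, g⟫ / ‖g‖ ^ 2) • g‖ ^ 2 = ‖d‖ ^ 2 * (1 - (⟪d, g⟫ / (‖d‖ * ‖g‖)) ^ 2) := by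
  have hd' : ‖d‖ ≠ 0 := norm_ne_zero_iff.mpr hd
  have hg' : ‖g‖ ≠ 0 := norm_ne_zero_iff.mpr hg
  rw [norm_sub_sq_real, inner_smul_right, norm_smul, mul_pow, Real.norm_eq_abs, sq_abs]
  field_simp
  ring

/-- A full step along `g` does not increase the norm when `‖g‖² ≤ ⟪d, g⟫`. -/
lemma norm_sub_sq_le_of_norm_sq_le_inner {d g : H} (h : ‖g‖ ^ 2 ≤ ⟪d, g⟫) :
    ‖d - g‖ ^ 2 ≤ ‖d‖ ^ 2 := by
  rw [norm_sub_sq_real]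
  linarith [sq_nonneg ‖g‖]

lemma one_sub_cos_sq_nonneg (d g : H) : 0 ≤ 1 - (⟪d, g⟫ / (‖d‖ * ‖g‖)) ^ 2 :=
  sub_nonneg.mpr <| (sq_le_one_iff_abs_le_one _).mpr <|
    abs_real_inner_div_norm_mul_norm_le_one d g

end LineSearch

lemma le_mul_prod_Icc_of_succ_le {u c : ℕ → ℝ} (n : ℕ) (hc : ∀ i ∈ Finset.Icc 1 n, 0 ≤ c i)
    (h : ∀ i ∈ Finset.Icc 1 n, u (i + 1) ≤ u i * c i) :
    u (n + 1) ≤ u 1 * ∏ i ∈ Finset.Icc 1 n, c i := by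
  induction n with
  | zero => simp
  | succ n ih =>
    have hsub : Finset.Icc 1 n ⊆ Finset.Icc 1 (n + 1) := Finset.Icc_subset_Icc_right n.le_succ
    have hmem : n + 1 ∈ Finset.Icc 1 (n + 1) := by simp
    rw [Finset.prod_Icc_succ_top (by omega), ← mul_assoc]
    exact (h _ hmem).trans <| mul_le_mul_of_nonneg_right
      (ih (fun i hi => hc i (hsub hi)) fun i hi => h i (hsub hi)) (hc _ hmem)

lemma eq_mul_prod_Icc_of_succ_eq {u c : ℕ → ℝ} (n : ℕ)
    (h : ∀ i ∈ Finset.Icc 1 n, u (i + 1) = u i * c i) :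
    u (n + 1) = u 1 * ∏ i ∈ Finset.Icc 1 n, c i := by
  induction n with
  | zero => simp
  | succ n ih =>
    have hsub : Finset.Icc 1 n ⊆ Finset.Icc 1 (n + 1) := Finset.Icc_subset_Icc_right n.le_succ
    rw [Finset.prod_Icc_succ_top (by omega), ← mul_assoc, h (n + 1) (by simp),
      ih fun i hi => h i (hsub hi)]

/-- Proposition 2: the squared worst-case error of the accelerated kernel herding
iteration contracts by `(1 - cos² θ_i)` at every line-search step with `γ_i ≠ 1`,
with equality when every step size is `< 1`. -/
theorem stmt_1 {H : Type*} [NormedAddCommGroup H] [InnerProductSpace ℝ H]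
    (μ : H) (ν g : ℕ → H) (γ ε cosθ : ℕ → ℝ) (T : ℕ)
    (hg : ∀ t, g t ≠ 0)
    (hpos : ∀ t, 0 ≤ ⟪μ - ν t, g t⟫)
    (hγ : ∀ t, γ t = min (⟪μ - ν t, g t⟫ / ‖g t‖ ^ 2) 1)
    (hstep : ∀ t, ν (t + 1) = ν t + γ t • g t)
    (hT : 1 ≤ T)
    (hne : ∀ i, 1 ≤ i → i ≤ T - 1 → ν i ≠ μ)
    (hε : ∀ t, ε t = (1 / 2) * ‖μ - ν t‖ ^ 2)
    (hcos : ∀ i, cosθ i = ⟪μ - ν i, g i⟫ / (‖μ - ν i‖ * ‖g i‖)) :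
    ε T ≤ ε 1 * ∏ i ∈ (Finset.Icc 1 (T - 1)).filter (fun i => γ i ≠ 1), (1 - (cosθ i) ^ 2)
    ∧ ((∀ i ∈ Finset.Icc 1 (T - 1), γ i < 1) →
        ε T = ε 1 * ∏ i ∈ Finset.Icc 1 (T - 1), (1 - (cosθ i) ^ 2)) := by
  obtain ⟨n, rfl⟩ : ∃ n, T = n + 1 := ⟨T - 1, by omega⟩
  simp only [Nat.add_sub_cancel] at hne ⊢
  have hsucc : ∀ i, μ - ν (i + 1) = (μ - ν i) - γ i • g i := fun i => by
    rw [hstep, sub_add_eq_sub_sub]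
  have hline : ∀ i ∈ Finset.Icc 1 n, γ i ≠ 1 → ε (i + 1) = ε i * (1 - (cosθ i) ^ 2) := by
    intro i hi hi1
    rw [Finset.mem_Icc] at hi
    have hd : μ - ν i ≠ 0 := sub_ne_zero.mpr (hne i hi.1 hi.2).symm
    have hγi : γ i = ⟪μ - ν i, g i⟫ / ‖g i‖ ^ 2 := by
      rcases min_choice (⟪μ - ν i, g i⟫ / ‖g i‖ ^ 2) 1 with h | h
      · rw [hγ, h]
      · exact absurd ((hγ i).trans h) hi1
    rw [hε, hε, hsucc, hγi, norm_sub_line_search_sq hd (hg i), hcos, mul_assoc]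
  have hfull : ∀ i, γ i = 1 → ε (i + 1) ≤ ε i := by
    intro i hi1
    have hle : 1 ≤ ⟪μ - ν i, g i⟫ / ‖g i‖ ^ 2 := by
      rw [← min_eq_right_iff, ← hγ, hi1]
    have hg2 : 0 < ‖g i‖ ^ 2 := pow_pos (norm_pos_iff.mpr (hg i)) 2
    rw [hε, hε, hsucc, hi1, one_smul]
    linarith [norm_sub_sq_le_of_norm_sq_le_inner ((one_le_div hg2).mp hle)]
  refine ⟨?_, fun hlt => eq_mul_prod_Icc_of_succ_eq n fun i hi => hline i hi (hlt i hi).ne⟩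
  rw [Finset.prod_filter]
  refine le_mul_prod_Icc_of_succ_le n (fun i _ => ?_) fun i hi => ?_
  · split_ifs
    · rw [hcos]
      exact one_sub_cos_sq_nonneg _ _
    · exact zero_le_one
  · split_ifs with h
    · exact (hline i hi h).le
    · rw [mul_one]
      exact hfull i (not_not.mp h)
end

section
/- Let H be a real inner product space and a, d ∈ H with d ≠ 0 and ‖a − d‖ ≤ ‖a‖. Set λ = ⟨a − d, −d/‖d‖⟩. Then 1 − λ/‖d‖ ≥ 1/2. -/
open RealInnerProductSpace

/-- Key computation of part (iii) of Proposition 1: the scaling coefficient of a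
backward step of positive matching pursuit stays at least `1/2`. -/
theorem stmt_4 {H : Type*} [NormedAddCommGroup H] [InnerProductSpace ℝ H]
    (a d : H) (hd : d ≠ 0) (h : ‖a - d‖ ≤ ‖a‖) :
    1 - ⟪a - d, -(‖d‖⁻¹ • d)⟫ / ‖d‖ ≥ 1 / 2 := by
  have hpos : 0 < ‖d‖ := norm_pos_iff.mpr hd
  have hsq : ‖a - d‖ ^ 2 ≤ ‖a‖ ^ 2 := by gcongr
  rw [norm_sub_sq_real] at hsq
  have hcoef : 1 - ⟪a - d, -(‖d‖⁻¹ • d)⟫ / ‖d‖ = ⟪a, d⟫ / ‖d‖ ^ 2 := by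
    rw [inner_neg_right, real_inner_smul_right, inner_sub_left, real_inner_self_eq_norm_sq]
    field_simp
    ring
  rw [hcoef, ge_iff_le, le_div_iff₀ (by positivity)]
  linarith
end

section
/- Let H be a real inner product space, S ⊆ H, μ, ν ∈ S, and d ∈ H with d ≠ 0. Set r = (μ − ν) − d. Suppose v* ∈ S satisfies ⟨r, v*⟩ ≥ ⟨r, v⟩ for all v ∈ S, and suppose ⟨r, v* − ν⟩ ≥ ⟨r, −d/‖d‖⟩. Then ⟨r, (‖d‖ + 1)·(v* − ν)⟩ ≥ ‖r‖². -/
open RealInnerProductSpace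

/-- Case (A) inequality in the proof of Proposition 3 (convergence of positive
matching pursuit): if the best atom direction beats the backward direction, then
`⟨r, (‖d‖+1)·(v* - ν)⟩ ≥ ‖r‖²`. -/
theorem stmt_5 {H : Type*} [NormedAddCommGroup H] [InnerProductSpace ℝ H]
    (S : Set H) (μ ν : H) (hμ : μ ∈ S) (hν : ν ∈ S) (d : H) (hd : d ≠ 0)
    (v' : H) (hv' : v' ∈ S)
    (hmax : ∀ v ∈ S, ⟪(μ - ν) - d, v⟫ ≤ ⟪(μ - ν) - d, v'⟫)
    (hcase : ⟪(μ - ν) - d, v' - ν⟫ ≥ ⟪(μ - ν) - d, -(‖d‖⁻¹ • d)⟫) :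
    ⟪(μ - ν) - d, (‖d‖ + 1) • (v' - ν)⟫ ≥ ‖(μ - ν) - d‖ ^ 2 := by
  have hd_pos : 0 < ‖d‖ := norm_pos_iff.mpr hd
  have h_norm : ‖(μ - ν) - d‖ ^ 2 = ⟪(μ - ν) - d, μ - ν⟫ - ⟪(μ - ν) - d, d⟫ := by
    rw [← inner_sub_right, real_inner_self_eq_norm_sq]
  rw [h_norm]
  have h_atom := hmax μ hμ
  generalize (μ - ν) - d = r at *
  have h_back : -⟪r, d⟫ ≤ ‖d‖ * ⟪r, v' - ν⟫ := by
    calc -⟪r, d⟫ = ‖d‖ * ⟪r, -(‖d‖⁻¹ • d)⟫ := by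
          rw [inner_neg_right, real_inner_smul_right]
          field_simp
      _ ≤ ‖d‖ * ⟪r, v' - ν⟫ := mul_le_mul_of_nonneg_left hcase hd_pos.le
  rw [real_inner_smul_right, add_mul, one_mul]
  have h_gap : ⟪r, μ - ν⟫ ≤ ⟪r, v' - ν⟫ := by
    simpa only [inner_sub_right, sub_le_sub_iff_right] using h_atom
  linarith
end

section
/- Let H be a real inner product space, S ⊆ H, μ, ν ∈ S, and d ∈ H with d ≠ 0. Set r = (μ − ν) − d. Suppose v* ∈ S satisfies ⟨r, v*⟩ ≥ ⟨r, v⟩ for all v ∈ S, and suppose ⟨r, −d/‖d‖⟩ ≥ ⟨r, v* − ν⟩. Then ⟨r, −d/‖d‖⟩ ≥ ‖r‖²/(‖d‖ + 1), and consequently ⟨r, −d/‖d‖⟩² ≥ ‖r‖⁴/(‖d‖ + 1)². -/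
open RealInnerProductSpace

/-- Case (B) inequality in the proof of Proposition 3 (convergence of positive
matching pursuit): if the backward direction beats the best atom direction, then
`⟨r, -d/‖d‖⟩ ≥ ‖r‖²/(‖d‖+1)` and hence `⟨r, -d/‖d‖⟩² ≥ ‖r‖⁴/(‖d‖+1)²`. -/
theorem stmt_6 {H : Type*} [NormedAddCommGroup H] [InnerProductSpace ℝ H]
    (S : Set H) (μ ν : H) (hμ : μ ∈ S) (hν : ν ∈ S) (d : H) (hd : d ≠ 0)
    (v' : H) (hv' : v' ∈ S)
    (hmax : ∀ v ∈ S, ⟪(μ - ν) - d, v⟫ ≤ ⟪(μ - ν) - d, v'⟫)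
    (hcase : ⟪(μ - ν) - d, -(‖d‖⁻¹ • d)⟫ ≥ ⟪(μ - ν) - d, v' - ν⟫) :
    ⟪(μ - ν) - d, -(‖d‖⁻¹ • d)⟫ ≥ ‖(μ - ν) - d‖ ^ 2 / (‖d‖ + 1) ∧
    ⟪(μ - ν) - d, -(‖d‖⁻¹ • d)⟫ ^ 2 ≥ ‖(μ - ν) - d‖ ^ 4 / (‖d‖ + 1) ^ 2 := by
  have hd' : 0 < ‖d‖ := norm_pos_iff.mpr hd
  have hr : ‖(μ - ν) - d‖ ^ 2 = ⟪(μ - ν) - d, μ⟫ - ⟪(μ - ν) - d, ν⟫ - ⟪(μ - ν) - d, d⟫ := by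
    rw [← real_inner_self_eq_norm_sq, ← inner_sub_right, ← inner_sub_right]
  have hdir : ⟪(μ - ν) - d, -(‖d‖⁻¹ • d)⟫ * ‖d‖ = -⟪(μ - ν) - d, d⟫ := by
    rw [inner_neg_right, real_inner_smul_right]
    field_simp
  have hbound : ‖(μ - ν) - d‖ ^ 2 / (‖d‖ + 1) ≤ ⟪(μ - ν) - d, -(‖d‖⁻¹ • d)⟫ := by
    rw [div_le_iff₀ (by positivity), mul_add, hdir, hr]
    rw [inner_sub_right _ v' ν] at hcase
    linarith [hmax μ hμ]
  refine ⟨hbound, ?_⟩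
  calc ‖(μ - ν) - d‖ ^ 4 / (‖d‖ + 1) ^ 2 = (‖(μ - ν) - d‖ ^ 2 / (‖d‖ + 1)) ^ 2 := by
        rw [div_pow, ← pow_mul]
    _ ≤ ⟪(μ - ν) - d, -(‖d‖⁻¹ • d)⟫ ^ 2 := pow_le_pow_left₀ (by positivity) hbound 2
end

section
/- Let H be a real inner product space, S ⊆ H, and μ, ν ∈ S with μ ≠ ν. Let B ≥ 1 satisfy ‖v − ν‖ ≤ B for all v ∈ S. Define sequences (d_k), (r_k), (v_k), (u_k) as follows: d_0 = 0; for each k ≥ 0, r_k = (μ − ν) − d_k; v_k ∈ S satisfies ⟨r_k, v_k⟩ ≥ ⟨r_k, v⟩ for all v ∈ S; u_0 = v_0 − ν, and for k ≥ 1, u_k = v_k − ν if d_k = 0 or ⟨r_k, v_k − ν⟩ ≥ ⟨r_k, −d_k/‖d_k‖⟩, and u_k = −d_k/‖d_k‖ otherwise; assume u_k ≠ 0 for all k, and set d_{k+1} = d_k + (⟨r_k, u_k⟩/‖u_k‖²)·u_k. Then for every k ≥ 0, ‖(μ − ν) − d_k‖² ≤ ‖μ − ν‖² / (1 + C·k·‖μ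 − ν‖²), where C = 1/((1 + 2‖μ − ν‖)²·B²). -/
open RealInnerProductSpace

/-- A nonnegative sequence step `E' ≤ E - c E²` propagates the bound `E (1 + c k E₀) ≤ E₀`. -/
theorem mul_one_add_le_of_le_sub_sq {E E' E₀ c k : ℝ} (hE : 0 ≤ E) (hE' : 0 ≤ E')
    (hE₀ : 0 ≤ E₀) (hc : 0 ≤ c) (hstep : E' ≤ E - c * E ^ 2)
    (ih : E * (1 + c * k * E₀) ≤ E₀) : E' * (1 + c * (k + 1) * E₀) ≤ E₀ := by
  rcases hE.eq_or_lt with rfl | hpos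
  · have : E' = 0 := le_antisymm (by simpa using hstep) hE'
    simpa [this] using hE₀
  · have h : E' * (1 + c * E) ≤ E := by
      have h1 : E' * (1 + c * E) ≤ (E - c * E ^ 2) * (1 + c * E) := by gcongr
      have h2 : 0 ≤ c ^ 2 * E ^ 3 := by positivity
      linarith
    have h3 := mul_le_mul_of_nonneg_left ih hE'
    have h4 := mul_le_mul_of_nonneg_left h hE₀
    refine le_of_mul_le_mul_left ?_ hpos
    linarith

/-- The squared residual after the optimal step along `u`. -/
theorem norm_sub_proj_sq {H : Type*} [NormedAddCommGroup H] [InnerProductSpace ℝ H]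
    (r u : H) (hu : u ≠ 0) :
    ‖r - (⟪r, u⟫ / ‖u‖ ^ 2) • u‖ ^ 2 = ‖r‖ ^ 2 - ⟪r, u⟫ ^ 2 / ‖u‖ ^ 2 := by
  have hn : ‖u‖ ≠ 0 := norm_ne_zero_iff.mpr hu
  rw [norm_sub_sq_real, inner_smul_right, norm_smul, mul_pow, Real.norm_eq_abs, sq_abs]
  field_simp
  ring

/-- Proposition 3 (with the explicit constant from its proof): positive matching
pursuit applied to approximate `μ - ν` by elements of the cone generated by
`S - ν` satisfies `‖(μ - ν) - d_k‖² ≤ ‖μ - ν‖²/(1 + C·k·‖μ - ν‖²)` with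
`C = 1/((1 + 2‖μ - ν‖)²·B²)`. -/
theorem stmt_7 {H : Type*} [NormedAddCommGroup H] [InnerProductSpace ℝ H]
    (S : Set H) (μ ν : H) (hμ : μ ∈ S) (hν : ν ∈ S) (hne : μ ≠ ν)
    (B : ℝ) (hB : 1 ≤ B) (hbound : ∀ v ∈ S, ‖v - ν‖ ≤ B)
    (d r v u : ℕ → H)
    (hd0 : d 0 = 0)
    (hr : ∀ k, r k = (μ - ν) - d k)
    (hvS : ∀ k, v k ∈ S)
    (hvmax : ∀ k, ∀ w ∈ S, ⟪r k, w⟫ ≤ ⟪r k, v k⟫)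
    (hu0 : u 0 = v 0 - ν)
    (huA : ∀ k, 1 ≤ k →
      (d k = 0 ∨ ⟪r k, v k - ν⟫ ≥ ⟪r k, -(‖d k‖⁻¹ • d k)⟫) → u k = v k - ν)
    (huB : ∀ k, 1 ≤ k →
      ¬(d k = 0 ∨ ⟪r k, v k - ν⟫ ≥ ⟪r k, -(‖d k‖⁻¹ • d k)⟫) →
        u k = -(‖d k‖⁻¹ • d k))
    (hu : ∀ k, u k ≠ 0)
    (hdsucc : ∀ k, d (k + 1) = d k + (⟪r k, u k⟫ / ‖u k‖ ^ 2) • u k) :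
    ∀ k : ℕ, ‖(μ - ν) - d k‖ ^ 2 ≤
      ‖μ - ν‖ ^ 2 /
        (1 + (1 / ((1 + 2 * ‖μ - ν‖) ^ 2 * B ^ 2)) * (k : ℝ) * ‖μ - ν‖ ^ 2) := by
  have hres : ∀ k, ‖r (k + 1)‖ ^ 2 = ‖r k‖ ^ 2 - ⟪r k, u k⟫ ^ 2 / ‖u k‖ ^ 2 := by
    intro k
    rw [← norm_sub_proj_sq _ _ (hu k), hr (k + 1), hdsucc, ← sub_sub, ← hr]
  have hr0 : r 0 = μ - ν := by rw [hr, hd0, sub_zero]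
  have hle : ∀ k, ‖r k‖ ≤ ‖μ - ν‖ := by
    intro k
    induction k with
    | zero => rw [hr0]
    | succ k ih =>
      refine le_trans ((sq_le_sq₀ (norm_nonneg _) (norm_nonneg _)).mp ?_) ih
      rw [hres]
      exact sub_le_self _ (by positivity)
  have hd : ∀ k, ‖d k‖ ≤ 2 * ‖μ - ν‖ := by
    intro k
    have h : d k = (μ - ν) - r k := by rw [hr]; abel
    rw [h]
    linarith [norm_sub_le (μ - ν) (r k), hle k]
  have hv : ∀ k, ∀ w ∈ S, ⟪r k, w - ν⟫ ≤ ⟪r k, v k - ν⟫ := by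
    intro k w hw
    rw [inner_sub_right, inner_sub_right]
    linarith [hvmax k w hw]
  have hback : ∀ k, -⟪r k, d k⟫ = ‖d k‖ * ⟪r k, -(‖d k‖⁻¹ • d k)⟫ := by
    intro k
    by_cases h : d k = 0
    · simp [h]
    · have hn : ‖d k‖ ≠ 0 := norm_ne_zero_iff.mpr h
      rw [inner_neg_right, inner_smul_right]
      field_simp
  -- the chosen direction is short and dominates both candidate directions
  have hdir : ∀ k, ‖u k‖ ≤ B ∧ ⟪r k, v k - ν⟫ ≤ ⟪r k, u k⟫ ∧
      -⟪r k, d k⟫ ≤ ‖d k‖ * ⟪r k, u k⟫ := by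
    intro k
    have hnn : 0 ≤ ⟪r k, v k - ν⟫ := by simpa using hv k ν hν
    by_cases hA : d k = 0 ∨ ⟪r k, v k - ν⟫ ≥ ⟪r k, -(‖d k‖⁻¹ • d k)⟫
    · have huk : u k = v k - ν := by
        rcases Nat.eq_zero_or_pos k with rfl | hk
        · exact hu0
        · exact huA k hk hA
      rw [huk]
      refine ⟨hbound _ (hvS k), le_rfl, ?_⟩
      rcases hA with h | h
      · simp [h]
      · rw [hback]
        exact mul_le_mul_of_nonneg_left h (norm_nonneg _)
    · have hk : 1 ≤ k := by
        rcases Nat.eq_zero_or_pos k with rfl | hk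
        · exact absurd (Or.inl hd0) hA
        · exact hk
      rw [huB k hk hA, hback]
      push Not at hA
      refine ⟨?_, hA.2.le, le_rfl⟩
      rw [norm_neg, norm_smul, norm_inv, norm_norm,
        inv_mul_cancel₀ (norm_ne_zero_iff.mpr hA.1)]
      exact hB
  have hgain : ∀ k, ‖r k‖ ^ 2 ≤ (1 + 2 * ‖μ - ν‖) * ⟪r k, u k⟫ := by
    intro k
    obtain ⟨-, h1, h2⟩ := hdir k
    have hnn : 0 ≤ ⟪r k, u k⟫ := le_trans (by simpa using hv k ν hν) h1
    have h3 : ‖r k‖ ^ 2 = ⟪r k, μ - ν⟫ - ⟪r k, d k⟫ := by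
      rw [← inner_sub_right, ← hr, real_inner_self_eq_norm_sq]
    have h4 := mul_le_mul_of_nonneg_right (hd k) hnn
    linarith [hv k μ hμ]
  set c : ℝ := 1 / ((1 + 2 * ‖μ - ν‖) ^ 2 * B ^ 2) with hc
  have hc0 : 0 ≤ c := by positivity
  have hstep : ∀ k, ‖r (k + 1)‖ ^ 2 ≤ ‖r k‖ ^ 2 - c * (‖r k‖ ^ 2) ^ 2 := by
    intro k
    rw [hres]
    gcongr
    have hun : 0 < ‖u k‖ := norm_pos_iff.mpr (hu k)
    calc c * (‖r k‖ ^ 2) ^ 2 ≤ c * ((1 + 2 * ‖μ - ν‖) * ⟪r k, u k⟫) ^ 2 := by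
          gcongr
          exact hgain k
      _ = ⟪r k, u k⟫ ^ 2 / B ^ 2 := by
          rw [hc]
          field_simp
      _ ≤ ⟪r k, u k⟫ ^ 2 / ‖u k‖ ^ 2 := by
          gcongr
          exact (hdir k).1
  intro k
  rw [← hr, le_div_iff₀ (by positivity)]
  induction k with
  | zero => simp [hr0]
  | succ k ih =>
    push_cast
    exact mul_one_add_le_of_le_sub_sq (by positivity) (by positivity) (by positivity) hc0
      (hstep k) ih
end

section
/- Let H be a real inner product space, a, d ∈ H with a ≠ 0 and d ≠ 0, C > 0, and k a natural number. If ‖a − d‖² ≤ ‖a‖²/(1 + C·k·‖a‖²), then ⟨a, d⟩/(‖a‖·‖d‖) ≥ 1 − (1/2)·(‖a‖/‖d‖)/(1 + C·k·‖a‖²). -/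
open RealInnerProductSpace

/-- Corollary 2 (cos θ_{t,k} lower bound): if the approximation error after `k`
rounds of positive matching pursuit satisfies `‖a - d‖² ≤ ‖a‖²/(1 + C·k·‖a‖²)`,
then `cos θ ≥ 1 - (1/2)·(‖a‖/‖d‖)/(1 + C·k·‖a‖²)`. -/
theorem stmt_9 {H : Type*} [NormedAddCommGroup H] [InnerProductSpace ℝ H]
    (a d : H) (ha : a ≠ 0) (hd : d ≠ 0) (C : ℝ) (hC : 0 < C) (k : ℕ)
    (h : ‖a - d‖ ^ 2 ≤ ‖a‖ ^ 2 / (1 + C * (k : ℝ) * ‖a‖ ^ 2)) :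
    ⟪a, d⟫ / (‖a‖ * ‖d‖) ≥
      1 - (1 / 2) * ((‖a‖ / ‖d‖) / (1 + C * (k : ℝ) * ‖a‖ ^ 2)) := by
  have hA : 0 < ‖a‖ := norm_pos_iff.mpr ha
  have hD : 0 < ‖d‖ := norm_pos_iff.mpr hd
  have hS : 0 < 1 + C * (k : ℝ) * ‖a‖ ^ 2 := by positivity
  rw [ge_iff_le, le_div_iff₀ (mul_pos hA hD)]
  have hexp : (1 - (1 / 2) * ((‖a‖ / ‖d‖) / (1 + C * (k : ℝ) * ‖a‖ ^ 2))) * (‖a‖ * ‖d‖) =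
      ‖a‖ * ‖d‖ - (1 / 2) * (‖a‖ ^ 2 / (1 + C * (k : ℝ) * ‖a‖ ^ 2)) := by
    field_simp
  rw [hexp]
  linarith [norm_sub_sq_real a d, sq_nonneg (‖a‖ - ‖d‖), sub_sq ‖a‖ ‖d‖]
end

section
/- Let p, q, α, β, γ be real numbers with α > 0, γ > 0, q > 0, with α·c² + 2β·c + γ > 0 for all c ≥ 0, and with p·√γ ≤ q·√α. Define g(c) = (c·p + q)/√(α·c² + 2β·c + γ) for c ≥ 0. Then g attains its supremum over [0, ∞), and there exists a maximizer c* ∈ [0, ∞) such that either c* = 0, or p·β − q·α ≠ 0 and c* = (q·β − p·γ)/(p·β − q·α). -/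
/-- Quotients by square roots are compared by cross-multiplying squares. -/
theorem div_sqrt_le_div_sqrt_of_sq_mul_le {a b x y : ℝ} (hx : 0 < x) (hy : 0 < y)
    (hb : 0 ≤ b) (h : a ^ 2 * y ≤ b ^ 2 * x) : a / √x ≤ b / √y := by
  rw [div_le_div_iff₀ (Real.sqrt_pos.2 hx) (Real.sqrt_pos.2 hy)]
  refine (abs_le_of_sq_le_sq' ?_ (by positivity)).2
  rwa [mul_pow, mul_pow, Real.sq_sqrt hx.le, Real.sq_sqrt hy.le]

/-- A quadratic with positive leading and nonpositive middle coefficient that is positive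
on `[0, ∞)` has negative discriminant. -/
theorem sq_lt_mul_of_quadratic_pos {α β γ : ℝ} (hα : 0 < α) (hβ : β ≤ 0)
    (hpos : ∀ c : ℝ, 0 ≤ c → 0 < α * c ^ 2 + 2 * β * c + γ) : β ^ 2 < α * γ := by
  have h := hpos (-β / α) (div_nonneg (neg_nonneg.2 hβ) hα.le)
  have e : α * (α * (-β / α) ^ 2 + 2 * β * (-β / α) + γ) = α * γ - β ^ 2 := by
    field_simp
    ring
  linarith [mul_pos hα h]

/-- Proposition 4: the alignment function `g(c) = (cp + q)/√(αc² + 2βc + γ)`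
attains its maximum over `c ≥ 0` either at `c = 0` or at the critical point
`(qβ - pγ)/(pβ - qα)` (and never in the limit `c → ∞`). -/
theorem stmt_10 (p q α β γ : ℝ) (hα : 0 < α) (hγ : 0 < γ) (hq : 0 < q)
    (hpos : ∀ c : ℝ, 0 ≤ c → 0 < α * c ^ 2 + 2 * β * c + γ)
    (hlim : p * Real.sqrt γ ≤ q * Real.sqrt α) :
    ∃ c' : ℝ, 0 ≤ c' ∧
      (∀ c : ℝ, 0 ≤ c →
        (c * p + q) / Real.sqrt (α * c ^ 2 + 2 * β * c + γ) ≤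
          (c' * p + q) / Real.sqrt (α * c' ^ 2 + 2 * β * c' + γ)) ∧
      (c' = 0 ∨ (p * β - q * α ≠ 0 ∧ c' = (q * β - p * γ) / (p * β - q * α))) := by
  have hsq : 0 ≤ p → p ^ 2 * γ ≤ q ^ 2 * α := fun hp => by
    have h := pow_le_pow_left₀ (by positivity) hlim 2
    rwa [mul_pow, mul_pow, Real.sq_sqrt hγ.le, Real.sq_sqrt hα.le] at h
  rcases le_or_gt (p * γ - q * β) 0 with hB | hB
  · refine ⟨0, le_rfl, fun c hc => ?_, Or.inl rfl⟩
    rcases le_or_gt (c * p + q) 0 with hN | hN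
    · exact (div_nonpos_of_nonpos_of_nonneg hN (Real.sqrt_nonneg _)).trans
        (div_nonneg (by linarith) (Real.sqrt_nonneg _))
    refine div_sqrt_le_div_sqrt_of_sq_mul_le (hpos c hc) (by simpa using hγ) (by linarith) ?_
    suffices h : 0 ≤ c * (q ^ 2 * α - p ^ 2 * γ) + 2 * q * (q * β - p * γ) by
      linarith [mul_nonneg hc h]
    have hqB : 0 ≤ q * (q * β - p * γ) := mul_nonneg hq.le (by linarith)
    rcases le_or_gt 0 p with hp | hp
    · linarith [mul_nonneg hc (sub_nonneg.2 (hsq hp))]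
    · have hS : 0 < q ^ 2 * α - 2 * (p * q * β) + p ^ 2 * γ := by
        have h := hpos (q / -p) (div_nonneg hq.le (by linarith))
        have e : p ^ 2 * (α * (q / -p) ^ 2 + 2 * β * (q / -p) + γ) =
            q ^ 2 * α - 2 * (p * q * β) + p ^ 2 * γ := by
          have := hp.ne
          field_simp
          ring
        rw [← e]
        exact mul_pos (sq_pos_of_neg hp) h
      -- the expression is affine in `c`, hence nonnegative between `0` and `-q / p`
      have e : q * (c * (q ^ 2 * α - p ^ 2 * γ) + 2 * q * (q * β - p * γ)) =
          c * q * (q ^ 2 * α - 2 * (p * q * β) + p ^ 2 * γ) +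
            (c * p + q) * (2 * (q * (q * β - p * γ))) := by ring
      refine nonneg_of_mul_nonneg_right (a := q) ?_ hq
      rw [e]
      positivity
  · obtain ⟨hA, hΔ⟩ : 0 < q * α - p * β ∧ β ^ 2 < α * γ := by
      rcases le_or_gt β 0 with hβ | hβ
      · have hΔ := sq_lt_mul_of_quadratic_pos hα hβ hpos
        refine ⟨?_, hΔ⟩
        rcases le_or_gt 0 p with hp | hp
        · linarith [mul_pos hq hα, mul_nonneg hp (neg_nonneg.2 hβ)]
        · refine pos_of_mul_pos_right (a := γ) ?_ hγ.le
          linarith [mul_pos hq (sub_pos.2 hΔ), mul_nonneg (neg_nonneg.2 hβ) hB.le]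
      · have hp : 0 < p := pos_of_mul_pos_left (by linarith [mul_pos hq hβ]) hγ.le
        have hA : 0 < q * α - p * β := by
          refine pos_of_mul_pos_right (a := q) ?_ hq.le
          linarith [hsq hp.le, mul_pos hp hB]
        refine ⟨hA, sub_pos.1 (pos_of_mul_pos_right (a := q) ?_ hq.le)⟩
        linarith [mul_pos hγ hA, mul_pos hβ hB]
    set A := q * α - p * β with hAdef
    set B := p * γ - q * β with hBdef
    have hc' : (q * β - p * γ) / (p * β - q * α) = B / A := by
      rw [← neg_div_neg_eq]
      congr 1 <;> ring
    have hBA : 0 ≤ B / A := (div_pos hB hA).le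
    refine ⟨B / A, hBA, fun c hc => ?_, Or.inr ⟨by linarith, hc'.symm⟩⟩
    -- the numerator and the quadratic at the critical point
    have hN : B / A * p + q = (p * B + q * A) / A := by
      field_simp
    have hD : α * (B / A) ^ 2 + 2 * β * (B / A) + γ =
        (α * γ - β ^ 2) * (p * B + q * A) / A ^ 2 := by
      field_simp
      rw [hAdef, hBdef]
      ring
    have hS : 0 < p * B + q * A := by
      have h := hpos _ hBA
      rw [hD] at h
      exact pos_of_mul_pos_right ((div_pos_iff_of_pos_right (by positivity)).1 h)
        (sub_pos.2 hΔ).le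
    refine div_sqrt_le_div_sqrt_of_sq_mul_le (hpos c hc) (hpos _ hBA) ?_ ?_
    · rw [hN]
      positivity
    · rw [hN, hD, div_pow, ← mul_div_assoc, div_mul_eq_mul_div]
      refine div_le_div_of_nonneg_right ?_ (by positivity)
      have e : (p * B + q * A) ^ 2 * (α * c ^ 2 + 2 * β * c + γ) -
          (c * p + q) ^ 2 * ((α * γ - β ^ 2) * (p * B + q * A)) =
          (p * B + q * A) * (c * A - B) ^ 2 := by
        rw [hAdef, hBdef]
        ring
      rw [← sub_nonneg, e]
      positivity
end

section
/- Let H be a real inner product space, V ⊆ H, ν ∈ H, and μ an element of the closure of the convex hull of V, with a := μ − ν ≠ 0. Let d ∈ H with d ≠ 0, ⟨a, d⟩ > 0, and ⟨a, d⟩ < ‖a‖·‖d‖. Then there exist v ∈ V and c > 0 such that d + c·(v − ν) ≠ 0 and ⟨a, d + c·(v − ν)⟩/‖d + c·(v − ν)‖ > ⟨a, d⟩/‖d‖. -/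
open RealInnerProductSpace

/-- A continuous linear functional taking a value above `r` on the closed convex hull of `V`
takes a value above `r` on `V`. -/
theorem exists_mem_lt_inner_of_mem_closure_convexHull {H : Type*} [NormedAddCommGroup H]
    [InnerProductSpace ℝ H] {V : Set H} {μ b : H} {r : ℝ}
    (hμ : μ ∈ closure (convexHull ℝ V)) (hr : r < ⟪b, μ⟫) : ∃ v ∈ V, r < ⟪b, v⟫ := by
  by_contra! h
  have hconv : Convex ℝ {x : H | ⟪b, x⟫ ≤ r} :=
    convex_halfSpace_le (innerSL ℝ b).toLinearMap.isLinear r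
  have hclosed : IsClosed {x : H | ⟪b, x⟫ ≤ r} := isClosed_le (by fun_prop) continuous_const
  exact hr.not_ge (closure_minimal (convexHull_min h hconv) hclosed hμ)

open Filter Topology in
/-- If `d` makes an acute angle with `a`, then moving `d` a little in a direction `w` with positive
directional derivative of the cosine strictly increases the alignment with `a`. -/
theorem exists_pos_inner_div_norm_lt {H : Type*} [NormedAddCommGroup H] [InnerProductSpace ℝ H]
    {a d w : H} (hpos : 0 < ⟪a, d⟫) (hw : ⟪a, d⟫ * ⟪d, w⟫ < ‖d‖ ^ 2 * ⟪a, w⟫) :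
    ∃ c : ℝ, 0 < c ∧ d + c • w ≠ 0 ∧ ⟪a, d⟫ / ‖d‖ < ⟪a, d + c • w⟫ / ‖d + c • w‖ := by
  have hd : 0 < ‖d‖ := norm_pos_iff.2 fun h => by simp [h] at hpos
  have h₁ : ∀ᶠ c : ℝ in 𝓝 0, 0 < ⟪a, d + c • w⟫ :=
    ContinuousAt.eventually_lt (by fun_prop) (by fun_prop) (by simpa using hpos)
  have h₂ : ∀ᶠ c : ℝ in 𝓝 0, 0 < 2 * ⟪a, d⟫ * (‖d‖ ^ 2 * ⟪a, w⟫ - ⟪a, d⟫ * ⟪d, w⟫) +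
      c * (⟪a, w⟫ ^ 2 * ‖d‖ ^ 2 - ⟪a, d⟫ ^ 2 * ‖w‖ ^ 2) :=
    ContinuousAt.eventually_lt (by fun_prop) (by fun_prop) (by
      have := mul_pos hpos (sub_pos.2 hw)
      linarith)
  obtain ⟨c, ⟨hc₁, hc₂⟩, hc⟩ :=
    (((h₁.and h₂).filter_mono nhdsWithin_le_nhds).and
      (self_mem_nhdsWithin : Set.Ioi (0 : ℝ) ∈ 𝓝[>] 0)).exists
  have hne : d + c • w ≠ 0 := fun h => by simp [h] at hc₁
  refine ⟨c, hc, hne, ?_⟩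
  rw [div_lt_div_iff₀ hd (norm_pos_iff.2 hne)]
  refine lt_of_pow_lt_pow_left₀ 2 (by positivity) ?_
  rw [mul_pow, mul_pow, norm_add_sq_real, norm_smul, mul_pow, Real.norm_eq_abs, sq_abs,
    inner_add_right, real_inner_smul_right, real_inner_smul_right]
  linear_combination mul_pos hc hc₂

/-- Theorem 3.1: if the current direction `d` is not perfectly aligned with the
negative gradient `a = μ - ν` (with `μ` in the closed convex hull of `V`), then
the greedy cos-maximization step can strictly increase the alignment using a
strictly positive coefficient `c`. -/
theorem stmt_11 {H : Type*} [NormedAddCommGroup H] [InnerProductSpace ℝ H]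
    (V : Set H) (ν : H) (μ : H) (hμ : μ ∈ closure (convexHull ℝ V))
    (ha : μ - ν ≠ 0) (d : H) (hd : d ≠ 0)
    (hpos : 0 < ⟪μ - ν, d⟫) (hnotmax : ⟪μ - ν, d⟫ < ‖μ - ν‖ * ‖d‖) :
    ∃ v ∈ V, ∃ c : ℝ, 0 < c ∧ d + c • (v - ν) ≠ 0 ∧
      ⟪μ - ν, d + c • (v - ν)⟫ / ‖d + c • (v - ν)‖ > ⟪μ - ν, d⟫ / ‖d‖ := by
  set a := μ - ν
  have hb : ⟪‖d‖ ^ 2 • a - ⟪a, d⟫ • d, ν⟫ < ⟪‖d‖ ^ 2 • a - ⟪a, d⟫ • d, μ⟫ := by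
    rw [← sub_pos, ← inner_sub_right, inner_sub_left, real_inner_smul_left, real_inner_smul_left,
      real_inner_self_eq_norm_sq, real_inner_comm a d]
    linear_combination pow_lt_pow_left₀ hnotmax hpos.le two_ne_zero
  obtain ⟨v, hv, hlt⟩ := exists_mem_lt_inner_of_mem_closure_convexHull hμ hb
  refine ⟨v, hv, exists_pos_inner_div_norm_lt hpos ?_⟩
  rw [← sub_pos, ← inner_sub_right, inner_sub_left, real_inner_smul_left,
    real_inner_smul_left] at hlt
  exact sub_pos.1 hlt
end

section
/- Let H be a real inner product space and let ν, a, d ∈ H with a ≠ 0, d ≠ 0, and ⟨a, d⟩ > 0. For w ∈ H with w ≠ 0 define P(w) = (⟨a, w⟩/‖w‖²)·w (the orthogonal projection of a onto the line ℝ·w). Let v ∈ H with v ≠ ν satisfy ⟨a − P(d), v − ν⟩ ≥ ‖a − P(d)‖². Then there exists c ≥ 0 such that d + c·(v − ν) ≠ 0 and ‖a − P(d + c·(v − ν))‖² ≤ ‖a − P(d)‖² − ‖a − P(d)‖⁴/‖v − ν‖². -/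
open RealInnerProductSpace

theorem norm_sub_smul_sq {H : Type*} [NormedAddCommGroup H] [InnerProductSpace ℝ H]
    (x w : H) (s : ℝ) : ‖x - s • w‖ ^ 2 = ‖x‖ ^ 2 - 2 * s * ⟪x, w⟫ + s ^ 2 * ‖w‖ ^ 2 := by
  rw [norm_sub_sq_real, real_inner_smul_right, norm_smul, mul_pow, Real.norm_eq_abs, sq_abs]
  ring

theorem norm_sub_lineProj_sq {H : Type*} [NormedAddCommGroup H] [InnerProductSpace ℝ H]
    (x w : H) :
    ‖x - (⟪x, w⟫ / ‖w‖ ^ 2) • w‖ ^ 2 = ‖x‖ ^ 2 - ⟪x, w⟫ ^ 2 / ‖w‖ ^ 2 := by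
  rcases eq_or_ne w 0 with rfl | hw
  · simp
  · have := norm_ne_zero_iff.mpr hw
    rw [norm_sub_smul_sq]
    field_simp
    ring

theorem norm_sub_lineProj_sq_le {H : Type*} [NormedAddCommGroup H] [InnerProductSpace ℝ H]
    (x w : H) (s : ℝ) :
    ‖x - (⟪x, w⟫ / ‖w‖ ^ 2) • w‖ ^ 2 ≤ ‖x - s • w‖ ^ 2 := by
  rcases eq_or_ne w 0 with rfl | hw
  · simp
  · have := norm_ne_zero_iff.mpr hw
    have key : ‖x - s • w‖ ^ 2 - (‖x‖ ^ 2 - ⟪x, w⟫ ^ 2 / ‖w‖ ^ 2) =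
        (s * ‖w‖ - ⟪x, w⟫ / ‖w‖) ^ 2 := by
      rw [norm_sub_smul_sq]
      field_simp
      ring
    rw [norm_sub_lineProj_sq]
    linarith [sq_nonneg (s * ‖w‖ - ⟪x, w⟫ / ‖w‖)]

/-- Single-step decrease of the greedy cos-maximization method (Algorithm 4):
if the atom direction `v - ν` has enough correlation with the projection
residual `a - P(d)`, then adding it with a suitable coefficient `c ≥ 0`
decreases `‖a - P(·)‖²` by at least `‖a - P(d)‖⁴/‖v - ν‖²`, where
`P(w) = (⟨a, w⟩/‖w‖²)·w` is the orthogonal projection of `a` onto `ℝ·w`. -/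
theorem stmt_12 {H : Type*} [NormedAddCommGroup H] [InnerProductSpace ℝ H]
    (ν a d : H) (ha : a ≠ 0) (hd : d ≠ 0) (hpos : 0 < ⟪a, d⟫)
    (P : H → H) (hP : ∀ w : H, P w = (⟪a, w⟫ / ‖w‖ ^ 2) • w)
    (v : H) (hv : v ≠ ν)
    (hcorr : ⟪a - P d, v - ν⟫ ≥ ‖a - P d‖ ^ 2) :
    ∃ c : ℝ, 0 ≤ c ∧ d + c • (v - ν) ≠ 0 ∧
      ‖a - P (d + c • (v - ν))‖ ^ 2 ≤
        ‖a - P d‖ ^ 2 - ‖a - P d‖ ^ 4 / ‖v - ν‖ ^ 2 := by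
  have hd' : 0 < ‖d‖ := norm_pos_iff.mpr hd
  set l : ℝ := ⟪a, d⟫ / ‖d‖ ^ 2 with hl
  have hl_pos : 0 < l := by positivity
  set r : H := a - P d with hr
  set u : H := v - ν
  have hrd : ‖r‖ ^ 2 < ‖a‖ ^ 2 := by
    rw [hr, hP, norm_sub_lineProj_sq]
    have : 0 < ⟪a, d⟫ ^ 2 / ‖d‖ ^ 2 := by positivity
    linarith
  have hru : 0 ≤ ⟪r, u⟫ := (sq_nonneg _).trans hcorr
  have hres : a - l • (d + (⟪r, u⟫ / ‖u‖ ^ 2 / l) • u) = r - (⟪r, u⟫ / ‖u‖ ^ 2) • u := by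
    rw [hr, hP, ← hl, smul_add, smul_smul, mul_div_cancel₀ _ hl_pos.ne', sub_sub]
  refine ⟨⟪r, u⟫ / ‖u‖ ^ 2 / l, by positivity, fun h => ?_, ?_⟩
  · rw [h, smul_zero, sub_zero] at hres
    have hle : ‖a‖ ^ 2 ≤ ‖r‖ ^ 2 := by
      rw [hres, norm_sub_lineProj_sq]
      exact sub_le_self _ (by positivity)
    exact hle.not_gt hrd
  · rw [hP]
    refine (norm_sub_lineProj_sq_le _ _ l).trans ?_
    rw [hres, norm_sub_lineProj_sq]
    have hsq : ‖r‖ ^ 4 ≤ ⟪r, u⟫ ^ 2 := by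
      calc ‖r‖ ^ 4 = (‖r‖ ^ 2) ^ 2 := by ring
        _ ≤ ⟪r, u⟫ ^ 2 := by gcongr
    gcongr
end

section
/- Let H be a real inner product space, V ⊆ H nonempty, ν ∈ H, and μ an element of the closure of the convex hull of V; set a := μ − ν. Let B > 0 satisfy ‖v − ν‖ ≤ B for all v ∈ V. For w ∈ H with w ≠ 0 define P(w) = (⟨a, w⟩/‖w‖²)·w. Let (d_k)_{k≥1} be a sequence in H with d_k ≠ 0 and ⟨a, d_k⟩ > 0 for all k, and suppose that for each k: ‖a − P(d_{k+1})‖² ≤ ‖a − P(d_k + c·(v − ν))‖² for every c ≥ 0 and v ∈ V with d_k + c·(v − ν) ≠ 0. Then for every k ≥ 1, ‖a − P(d_k)‖² ≤ η₁/(1 + (k−1)·η₁/B²), where η₁ = ‖a − P(d_1)‖². In particular, ‖a − P(d_k)‖² = O(1/k). -/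
open RealInnerProductSpace

/-- The orthogonal projection of `a` on the line of `w` is at least as close to `a` as any
multiple of `w`. -/
theorem norm_sub_proj_sq_le_norm_sub_smul_sq {H : Type*} [NormedAddCommGroup H]
    [InnerProductSpace ℝ H] (a w : H) (s : ℝ) :
    ‖a - (⟪a, w⟫ / ‖w‖ ^ 2) • w‖ ^ 2 ≤ ‖a - s • w‖ ^ 2 := by
  rcases eq_or_ne w 0 with rfl | hw
  · simp
  have hw2 : 0 < ‖w‖ ^ 2 := by positivity
  have hq : ⟪a, w⟫ = (⟪a, w⟫ / ‖w‖ ^ 2) * ‖w‖ ^ 2 := by field_simp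
  rw [norm_sub_sq_real, norm_sub_sq_real, real_inner_smul_right, real_inner_smul_right,
    norm_smul, norm_smul, mul_pow, mul_pow, Real.norm_eq_abs, Real.norm_eq_abs, sq_abs, sq_abs]
  generalize ⟪a, w⟫ / ‖w‖ ^ 2 = q at hq ⊢
  rw [hq]
  nlinarith [mul_nonneg hw2.le (sq_nonneg (s - q))]

/-- A linear functional bounded by `M` on a translate `V - ν` is bounded by `M` at `μ - ν` for
every `μ` in the closed convex hull of `V`. -/
theorem inner_sub_le_of_mem_closure_convexHull {H : Type*} [NormedAddCommGroup H]
    [InnerProductSpace ℝ H] {V : Set H} {ν μ r : H} {M : ℝ}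
    (hμ : μ ∈ closure (convexHull ℝ V)) (hM : ∀ v ∈ V, ⟪r, v - ν⟫ ≤ M) :
    ⟪r, μ - ν⟫ ≤ M := by
  have hconv : Convex ℝ {x : H | ⟪r, x⟫ ≤ M + ⟪r, ν⟫} :=
    convex_halfSpace_le (innerₛₗ ℝ r).isLinear _
  have hclosed : IsClosed {x : H | ⟪r, x⟫ ≤ M + ⟪r, ν⟫} :=
    isClosed_le (by fun_prop) continuous_const
  have hsub : V ⊆ {x : H | ⟪r, x⟫ ≤ M + ⟪r, ν⟫} := fun v hv => by
    have := hM v hv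
    rw [inner_sub_right] at this
    simp only [Set.mem_ofPred_eq]
    linarith
  have h := closure_minimal (convexHull_min hsub hconv) hclosed hμ
  simp only [Set.mem_ofPred_eq] at h
  rw [inner_sub_right]
  linarith

/-- One greedy round decreases the squared residual `η` at least by `η ^ 2 / B ^ 2`. -/
theorem greedy_residual_sq_le {H : Type*} [NormedAddCommGroup H] [InnerProductSpace ℝ H]
    {V : Set H} (hV : V.Nonempty) {ν μ : H} (hμ : μ ∈ closure (convexHull ℝ V))
    {B : ℝ} (hB : 0 < B) (hbound : ∀ v ∈ V, ‖v - ν‖ ≤ B)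
    {P : H → H} (hP : ∀ w : H, P w = (⟪μ - ν, w⟫ / ‖w‖ ^ 2) • w)
    {x : H} (hx : x ≠ 0) (hax : 0 < ⟪μ - ν, x⟫) {η' : ℝ}
    (hη' : ∀ c : ℝ, 0 ≤ c → ∀ v ∈ V, x + c • (v - ν) ≠ 0 →
      η' ≤ ‖(μ - ν) - P (x + c • (v - ν))‖ ^ 2) :
    (‖(μ - ν) - P x‖ ^ 2) ^ 2 ≤ B ^ 2 * (‖(μ - ν) - P x‖ ^ 2 - η') := by
  set a := μ - ν with ha
  have hx2 : 0 < ‖x‖ ^ 2 := by positivity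
  obtain ⟨l, hl⟩ : ∃ l, l = ⟪a, x⟫ / ‖x‖ ^ 2 := ⟨_, rfl⟩
  have hl0 : 0 < l := hl ▸ div_pos hax hx2
  have hPx : P x = l • x := by rw [hP, hl]
  have hinner : ⟪a, x⟫ = l * ‖x‖ ^ 2 := by rw [hl]; field_simp
  have hle : η' ≤ ‖a - P x‖ ^ 2 := by
    obtain ⟨v, hv⟩ := hV
    simpa using hη' 0 le_rfl v hv (by simpa using hx)
  rw [hPx] at hle ⊢
  obtain ⟨r, hr⟩ : ∃ r, r = a - l • x := ⟨_, rfl⟩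
  have hrx : ⟪r, x⟫ = 0 := by
    rw [hr, inner_sub_left, real_inner_smul_left, real_inner_self_eq_norm_sq, hinner, sub_self]
  have har : a = r + l • x := by rw [hr]; abel
  have hra : ⟪r, a⟫ = ‖r‖ ^ 2 := by
    rw [har, inner_add_right, real_inner_smul_right, hrx, real_inner_self_eq_norm_sq]
    ring
  have hna : ‖r‖ ^ 2 < ‖a‖ ^ 2 := by
    rw [har, norm_add_sq_real, real_inner_smul_right, hrx, norm_smul, mul_pow]
    have : 0 < ‖l‖ ^ 2 * ‖x‖ ^ 2 := mul_pos (pow_pos (norm_pos_iff.2 hl0.ne') 2) hx2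
    linarith
  rw [← hr] at hle ⊢
  have hkey : ∀ v ∈ V, ⟪r, v - ν⟫ ≤ √(B ^ 2 * (‖r‖ ^ 2 - η')) := by
    intro v hv
    rcases le_or_gt ⟪r, v - ν⟫ 0 with hneg | hpos
    · exact hneg.trans (Real.sqrt_nonneg _)
    apply Real.le_sqrt_of_sq_le
    have hz := hbound v hv
    obtain ⟨i, hi⟩ : ∃ i, i = ⟪r, v - ν⟫ := ⟨_, rfl⟩
    obtain ⟨c, hc⟩ : ∃ c, c = i / B ^ 2 := ⟨_, rfl⟩
    rw [← hi] at hpos ⊢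
    have hc0 : 0 < c := by rw [hc]; positivity
    have hw : a - l • (x + (c / l) • (v - ν)) = r - c • (v - ν) := by
      rw [smul_add, smul_smul, mul_div_cancel₀ _ hl0.ne', hr, sub_sub a]
    have hdecr : B ^ 2 * ‖r - c • (v - ν)‖ ^ 2 ≤ B ^ 2 * ‖r‖ ^ 2 - i ^ 2 := by
      rw [norm_sub_sq_real, real_inner_smul_right, norm_smul, mul_pow, Real.norm_eq_abs, sq_abs,
        ← hi]
      have hcB : i = c * B ^ 2 := by rw [hc]; field_simp
      have hz2 : ‖v - ν‖ ^ 2 ≤ B ^ 2 := by gcongr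
      have : B ^ 2 * (c ^ 2 * ‖v - ν‖ ^ 2) ≤ B ^ 2 * (c ^ 2 * B ^ 2) := by gcongr
      rw [hcB]
      linarith
    have hw0 : x + (c / l) • (v - ν) ≠ 0 := by
      intro h0
      rw [h0, smul_zero, sub_zero] at hw
      rw [← hw] at hdecr
      have : B ^ 2 * ‖r‖ ^ 2 < B ^ 2 * ‖a‖ ^ 2 := by gcongr
      linarith [sq_nonneg i]
    have h1 := hη' (c / l) (by positivity) v hv hw0
    rw [hP] at h1
    have h2 := h1.trans (norm_sub_proj_sq_le_norm_sub_smul_sq a _ l)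
    rw [hw] at h2
    have h3 : B ^ 2 * η' ≤ B ^ 2 * ‖r - c • (v - ν)‖ ^ 2 := by gcongr
    linarith
  have h := inner_sub_le_of_mem_closure_convexHull hμ hkey
  rw [← ha, hra] at h
  have hnn : 0 ≤ B ^ 2 * (‖r‖ ^ 2 - η') := mul_nonneg (by positivity) (by linarith)
  calc (‖r‖ ^ 2) ^ 2 ≤ √(B ^ 2 * (‖r‖ ^ 2 - η')) ^ 2 := by gcongr
    _ = _ := Real.sq_sqrt hnn

/-- If `η (k + 1) ≤ η k - η k ^ 2 / B ^ 2`, then `1 / η` grows at least linearly with slope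
`1 / B ^ 2`. -/
theorem le_div_of_sq_le_mul_sub {η : ℕ → ℝ} {B : ℝ} (hB : 0 < B) (hη : ∀ k, 0 ≤ η k)
    (hstep : ∀ k, 1 ≤ k → η k ^ 2 ≤ B ^ 2 * (η k - η (k + 1))) (k : ℕ) (hk : 1 ≤ k) :
    η k ≤ η 1 / (1 + ((k : ℝ) - 1) * η 1 / B ^ 2) := by
  induction k, hk using Nat.le_induction with
  | base => simp
  | succ k hk ih =>
    have hk' : (0 : ℝ) ≤ (k : ℝ) - 1 := by
      rw [sub_nonneg]
      exact_mod_cast hk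
    have h1 := hη 1
    have hB2 : 0 < B ^ 2 := by positivity
    have hX : 0 < 1 + ((k : ℝ) - 1) * η 1 / B ^ 2 := by positivity
    have hY : 1 + (((k + 1 : ℕ) : ℝ) - 1) * η 1 / B ^ 2 =
        (1 + ((k : ℝ) - 1) * η 1 / B ^ 2) + η 1 / B ^ 2 := by
      push_cast
      ring
    rw [hY]
    generalize 1 + ((k : ℝ) - 1) * η 1 / B ^ 2 = X at *
    have ht : 0 ≤ η 1 / B ^ 2 := by positivity
    rw [le_div_iff₀ hX] at ih
    rw [le_div_iff₀ (by positivity)]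
    have hs : η (k + 1) ≤ η k - η k ^ 2 / B ^ 2 := by
      have : η k ^ 2 / B ^ 2 ≤ η k - η (k + 1) := by
        rw [div_le_iff₀ hB2]
        linarith [hstep k hk]
      linarith
    have hk0 : 0 ≤ η k := hη k
    have hdrop : η (k + 1) * (1 + η k / B ^ 2) ≤ η k := by
      calc η (k + 1) * (1 + η k / B ^ 2) ≤ (η k - η k ^ 2 / B ^ 2) * (1 + η k / B ^ 2) := by
            gcongr
        _ = η k - η k * (η k / B ^ 2) ^ 2 := by ring
        _ ≤ η k := sub_le_self _ (by positivity)
    have hpos : 0 < 1 + η k / B ^ 2 := by positivity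
    refine le_of_mul_le_mul_right ?_ hpos
    calc η (k + 1) * (X + η 1 / B ^ 2) * (1 + η k / B ^ 2)
        = (η (k + 1) * (1 + η k / B ^ 2)) * (X + η 1 / B ^ 2) := by ring
      _ ≤ η k * (X + η 1 / B ^ 2) := by gcongr
      _ = η k * X + η 1 * (η k / B ^ 2) := by ring
      _ ≤ η 1 + η 1 * (η k / B ^ 2) := by gcongr
      _ = η 1 * (1 + η k / B ^ 2) := by ring

/-- The paper's theorem on the `O(1/k)` convergence of the greedy
cos-maximization method (Algorithm 4): if at each round the new direction is at
least as good (as measured by `‖a - P(·)‖²`) as any update `d_k + c(v - ν)` with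
`c ≥ 0`, `v ∈ V`, then `‖a - P(d_k)‖² ≤ η₁/(1 + (k-1)·η₁/B²)`, where
`P(w) = (⟨a, w⟩/‖w‖²)·w` and `η₁ = ‖a - P(d_1)‖²`; in particular
`‖a - P(d_k)‖² = O(1/k)`. -/
theorem stmt_13 {H : Type*} [NormedAddCommGroup H] [InnerProductSpace ℝ H]
    (V : Set H) (hV : V.Nonempty) (ν : H) (μ : H)
    (hμ : μ ∈ closure (convexHull ℝ V))
    (B : ℝ) (hB : 0 < B) (hbound : ∀ v ∈ V, ‖v - ν‖ ≤ B)
    (P : H → H) (hP : ∀ w : H, P w = (⟪μ - ν, w⟫ / ‖w‖ ^ 2) • w)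
    (d : ℕ → H)
    (hd : ∀ k, 1 ≤ k → d k ≠ 0 ∧ 0 < ⟪μ - ν, d k⟫)
    (hgreedy : ∀ k, 1 ≤ k → ∀ c : ℝ, 0 ≤ c → ∀ v ∈ V,
      d k + c • (v - ν) ≠ 0 →
        ‖(μ - ν) - P (d (k + 1))‖ ^ 2 ≤ ‖(μ - ν) - P (d k + c • (v - ν))‖ ^ 2) :
    (∀ k : ℕ, 1 ≤ k →
      ‖(μ - ν) - P (d k)‖ ^ 2 ≤
        ‖(μ - ν) - P (d 1)‖ ^ 2 /
          (1 + ((k : ℝ) - 1) * ‖(μ - ν) - P (d 1)‖ ^ 2 / B ^ 2)) ∧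
    ∃ C : ℝ, ∀ k : ℕ, 1 ≤ k → ‖(μ - ν) - P (d k)‖ ^ 2 ≤ C / (k : ℝ) := by
  have hmain := le_div_of_sq_le_mul_sub (η := fun k => ‖(μ - ν) - P (d k)‖ ^ 2) hB
    (fun k => sq_nonneg _) fun k hk =>
      greedy_residual_sq_le hV hμ hB hbound hP (hd k hk).1 (hd k hk).2 (hgreedy k hk)
  refine ⟨hmain, ‖(μ - ν) - P (d 1)‖ ^ 2 + B ^ 2, fun k hk => (hmain k hk).trans ?_⟩
  have hη : 0 ≤ ‖(μ - ν) - P (d 1)‖ ^ 2 := sq_nonneg _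
  generalize ‖(μ - ν) - P (d 1)‖ ^ 2 = η at hη ⊢
  have hk' : (0 : ℝ) ≤ (k : ℝ) - 1 := by
    rw [sub_nonneg]
    exact_mod_cast hk
  have hk0 : (0 : ℝ) < k := by linarith
  rw [div_le_div_iff₀ (by positivity) hk0]
  have hexp : (η + B ^ 2) * (1 + ((k : ℝ) - 1) * η / B ^ 2) =
      η * k + (B ^ 2 + η * (((k : ℝ) - 1) * η / B ^ 2)) := by
    field_simp
    ring
  rw [hexp]
  exact le_add_of_nonneg_right (by positivity)
end

section
/- Let H be a real inner product space, a ∈ H with a ≠ 0, and let C ⊆ H be closed under multiplication by nonnegative scalars (t·d ∈ C for all d ∈ C and t ≥ 0). Suppose d* ∈ C with d* ≠ 0 satisfies ‖a − d*‖ ≤ ‖a − d‖ for all d ∈ C. Then ⟨a − d*, d*⟩ = 0, and for every d ∈ C with d ≠ 0, ⟨a, d*⟩/(‖a‖·‖d*‖) ≥ ⟨a, d⟩/(‖a‖·‖d‖). -/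
open RealInnerProductSpace

/-- Minimality of `x` on a cone, with the squared norms expanded along a ray. -/
lemma norm_sq_sub_two_inner_le_of_forall_norm_sub_le {H : Type*} [NormedAddCommGroup H]
    [InnerProductSpace ℝ H] {a x : H} {C : Set H}
    (hC : ∀ d ∈ C, ∀ t : ℝ, 0 ≤ t → t • d ∈ C) (hx : ∀ d ∈ C, ‖a - x‖ ≤ ‖a - d‖)
    {d : H} (hd : d ∈ C) {t : ℝ} (ht : 0 ≤ t) :
    ‖x‖ ^ 2 - 2 * ⟪a, x⟫ ≤ t ^ 2 * ‖d‖ ^ 2 - 2 * (t * ⟪a, d⟫) := by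
  have h := pow_le_pow_left₀ (norm_nonneg _) (hx _ (hC d hd t ht)) 2
  rw [norm_sub_sq_real, norm_sub_sq_real, real_inner_smul_right, norm_smul, mul_pow,
    Real.norm_eq_abs, sq_abs] at h
  linarith

/-- Equivalence of problems (min-prob1) and (min-prob2) in Section 3.3: the
minimizer `d*` of `‖a - d‖` over a cone `C` is its own orthogonal projection of
`a` (i.e. `⟨a - d*, d*⟩ = 0`) and maximizes the cosine of the angle with `a`
over all nonzero elements of `C`. -/
theorem stmt_17 {H : Type*} [NormedAddCommGroup H] [InnerProductSpace ℝ H]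
    (a : H) (ha : a ≠ 0) (C : Set H)
    (hcone : ∀ d ∈ C, ∀ t : ℝ, 0 ≤ t → t • d ∈ C)
    (dstar : H) (hdC : dstar ∈ C) (hdne : dstar ≠ 0)
    (hmin : ∀ d ∈ C, ‖a - dstar‖ ≤ ‖a - d‖) :
    ⟪a - dstar, dstar⟫ = 0 ∧
    ∀ d ∈ C, d ≠ 0 →
      ⟪a, dstar⟫ / (‖a‖ * ‖dstar‖) ≥ ⟪a, d⟫ / (‖a‖ * ‖d‖) := by
  have key {d : H} (hd : d ∈ C) {t : ℝ} (ht : 0 ≤ t) :=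
    norm_sq_sub_two_inner_le_of_forall_norm_sub_le hcone hmin hd ht
  have hs : 0 < ‖dstar‖ := norm_pos_iff.mpr hdne
  have hinner : ⟪a, dstar⟫ = ‖dstar‖ ^ 2 := by
    have h0 := key hdC le_rfl
    have hp : 0 ≤ ⟪a, dstar⟫ := by nlinarith
    have h1 := key hdC (t := ⟪a, dstar⟫ / ‖dstar‖ ^ 2) (by positivity)
    have h2 : (⟪a, dstar⟫ / ‖dstar‖ ^ 2) * ‖dstar‖ ^ 2 = ⟪a, dstar⟫ := by field_simp
    set u := ⟪a, dstar⟫ / ‖dstar‖ ^ 2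
    rw [← h2] at h1
    have h3 : (u - 1) ^ 2 * ‖dstar‖ ^ 2 ≤ 0 := by linarith
    have h4 : (u - 1) ^ 2 ≤ 0 := nonpos_of_mul_nonpos_left h3 (by positivity)
    have h5 : u = 1 := sub_eq_zero.mp (sq_eq_zero_iff.mp (h4.antisymm (sq_nonneg _)))
    rw [← h2, h5, one_mul]
  refine ⟨by rw [inner_sub_left, hinner, real_inner_self_eq_norm_sq, sub_self], ?_⟩
  intro d hd hd0
  have hn : 0 < ‖d‖ := norm_pos_iff.mpr hd0
  have hA : 0 < ‖a‖ := norm_pos_iff.mpr ha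
  have h := key hd (t := ‖dstar‖ / ‖d‖) (by positivity)
  rw [hinner, ← mul_pow, div_mul_cancel₀ _ hn.ne'] at h
  have hle : ‖dstar‖ * ⟪a, d⟫ ≤ ‖dstar‖ * (‖dstar‖ * ‖d‖) := by
    have h' : ‖dstar‖ * ⟪a, d⟫ / ‖d‖ ≤ ‖dstar‖ ^ 2 := by
      rw [mul_div_right_comm]; linarith
    rw [div_le_iff₀ hn] at h'
    linarith
  have hr : ⟪a, d⟫ ≤ ‖dstar‖ * ‖d‖ := le_of_mul_le_mul_left hle hs
  rw [ge_iff_le, hinner, div_le_div_iff₀ (by positivity) (by positivity)]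
  calc ⟪a, d⟫ * (‖a‖ * ‖dstar‖) ≤ ‖dstar‖ * ‖d‖ * (‖a‖ * ‖dstar‖) := by gcongr
    _ = ‖dstar‖ ^ 2 * (‖a‖ * ‖d‖) := by ring
end
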